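/- Let X be a second-countable locally compact Hausdorff space and let κ be a kernel on X satisfying (R1), (R2), (R3), with Frostman's maximum principle (h = 1) in place of h-Ugaheri's. Let A ⊂ X, A ≠ X, with cp_*A > 0, and let ω be a nonzero positive Radon measure with either I(ω) < ∞, or ω concentrated on X∖A and ω(X) < ∞. Then the inner balayage ω^A has minimum total mass in the class Γ_{A,ω} := { ν ∈ E⁺ : U^ν ≥ U^ω nearly everywhere on A }; that is, ω^A(X) = min over ν ∈ Γ_{A,ω} of ν(X). -/

import Mathlib

open MeasureTheory Filter Set Topology ENNReal CompactlySupported UniformConvergence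

namespace Balayage
open scoped Classical

variable {X : Type*} [TopologicalSpace X] [MeasurableSpace X]

/-- A kernel: symmetric, lower semicontinuous, `[0,∞]`-valued. -/
structure IsKernel (κ : X → X → ℝ≥0∞) : Prop where
  symm : ∀ x y, κ x y = κ y x
  lsc : LowerSemicontinuous fun p : X × X => κ p.1 p.2

/-- The potential `U^μ(x) = ∫ κ(x,y) dμ(y)`. -/
noncomputable def potential (κ : X → X → ℝ≥0∞) (μ : Measure X) (x : X) : ℝ≥0∞ :=
  ∫⁻ y, κ x y ∂μ

/-- The mutual energy `I(μ,ν) = ∫∫ κ(x,y) dν(y) dμ(x)` of two positive measures. -/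
noncomputable def energy (κ : X → X → ℝ≥0∞) (μ ν : Measure X) : ℝ≥0∞ :=
  ∫⁻ x, potential κ ν x ∂μ

/-- A positive Radon measure (regular Borel measure, finite on compacts). -/
def IsRadon (μ : Measure X) : Prop := μ.Regular

/-- Finite energy: `I(μ) < ∞`. -/
def FiniteEnergy (κ : X → X → ℝ≥0∞) (μ : Measure X) : Prop := energy κ μ μ < ⊤

/-- Membership in the cone `E⁺` of positive Radon measures of finite energy. -/
def memE (κ : X → X → ℝ≥0∞) (μ : Measure X) : Prop := IsRadon μ ∧ FiniteEnergy κ μ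

/-- Membership in `E⁺(A)`: measures of `E⁺` concentrated on `A`
(i.e. the complement of `A` is negligible). -/
def memEOn (κ : X → X → ℝ≥0∞) (A : Set X) (μ : Measure X) : Prop :=
  memE κ μ ∧ μ Aᶜ = 0

/-- The strong (energy) distance `‖μ-ν‖ = √(I(μ)+I(ν)-2I(μ,ν))`. -/
noncomputable def sDist (κ : X → X → ℝ≥0∞) (μ ν : Measure X) : ℝ :=
  Real.sqrt ((energy κ μ μ).toReal + (energy κ ν ν).toReal - 2 * (energy κ μ ν).toReal)

/-- Membership in `E'(A)`, the strong closure of `E⁺(A)` in `E⁺`. -/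
def memEClos (κ : X → X → ℝ≥0∞) (A : Set X) (μ : Measure X) : Prop :=
  memE κ μ ∧ ∀ ε : ℝ, 0 < ε → ∃ ν, memEOn κ A ν ∧ sDist κ μ ν < ε

/-- The capacity of a compact set: the inverse of the minimal energy of
probability measures concentrated on it. -/
noncomputable def capC (κ : X → X → ℝ≥0∞) (K : Set X) : ℝ≥0∞ :=
  (⨅ (μ : Measure X) (_ : IsProbabilityMeasure μ) (_ : μ Kᶜ = 0), energy κ μ μ)⁻¹

/-- The inner capacity `cp_* A`: supremum of capacities of compact subsets. -/
noncomputable def innerCap (κ : X → X → ℝ≥0∞) (A : Set X) : ℝ≥0∞ :=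
  ⨆ (K : Set X) (_ : IsCompact K) (_ : K ⊆ A), capC κ K

/-- The outer capacity `cp^* A`: infimum of inner capacities of open supersets. -/
noncomputable def outerCap (κ : X → X → ℝ≥0∞) (A : Set X) : ℝ≥0∞ :=
  ⨅ (D : Set X) (_ : IsOpen D) (_ : A ⊆ D), innerCap κ D

/-- Strict positive definiteness (energy principle), stated for pairs of positive
measures of finite energy: `I(μ-ν) ≥ 0`, with equality only for `μ = ν`. -/
def StrictlyPosDef (κ : X → X → ℝ≥0∞) : Prop :=
  ∀ μ ν : Measure X, IsRadon μ → IsRadon ν → FiniteEnergy κ μ → FiniteEnergy κ ν →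
    (2 * energy κ μ ν ≤ energy κ μ μ + energy κ ν ν) ∧
    (2 * energy κ μ ν = energy κ μ μ + energy κ ν ν → μ = ν)

/-- Vague convergence of a sequence of measures: convergence of integrals of
continuous compactly supported functions. -/
def VagueTendsto (μ : ℕ → Measure X) (μ₀ : Measure X) : Prop :=
  ∀ f : X → ℝ, Continuous f → HasCompactSupport f →
    Tendsto (fun j => ∫ x, f x ∂(μ j)) atTop (nhds (∫ x, f x ∂μ₀))

/-- A perfect kernel: strictly positive definite, `E⁺` strongly complete, and the strong
topology on `E⁺` finer than the vague topology (sequential formulation; sequences suffice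
on second-countable spaces). -/
structure Perfect (κ : X → X → ℝ≥0∞) : Prop where
  posdef : StrictlyPosDef κ
  complete : ∀ μ : ℕ → Measure X, (∀ j, memE κ (μ j)) →
    (∀ ε : ℝ, 0 < ε → ∃ N, ∀ m ≥ N, ∀ n ≥ N, sDist κ (μ m) (μ n) < ε) →
    ∃ μ₀, memE κ μ₀ ∧ Tendsto (fun j => sDist κ (μ j) μ₀) atTop (nhds 0)
  finerThanVague : ∀ (μ : ℕ → Measure X) (μ₀ : Measure X), (∀ j, memE κ (μ j)) →
    memE κ μ₀ → Tendsto (fun j => sDist κ (μ j) μ₀) atTop (nhds 0) → VagueTendsto μ μ₀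

/-- The domination principle. -/
def Domination (κ : X → X → ℝ≥0∞) : Prop :=
  ∀ μ ν : Measure X, memE κ μ → IsRadon ν →
    (∀ᵐ x ∂μ, potential κ μ x ≤ potential κ ν x) → ∀ x, potential κ μ x ≤ potential κ ν x

/-- `h`-Ugaheri's maximum principle; for `h = 1` this is Frostman's maximum principle. -/
def Ugaheri (κ : X → X → ℝ≥0∞) (h : ℝ) : Prop :=
  ∀ μ : Measure X, memE κ μ → ∀ c : ℝ, 0 < c →
    (∀ᵐ x ∂μ, potential κ μ x ≤ ENNReal.ofReal c) →
    ∀ x, potential κ μ x ≤ ENNReal.ofReal (h * c)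

/-- Condition (R1): the kernel is perfect and satisfies the domination and
`h`-Ugaheri maximum principles for some `h ∈ [1, ∞)`. -/
structure R1 (κ : X → X → ℝ≥0∞) : Prop where
  perfect : Perfect κ
  domination : Domination κ
  ugaheri : ∃ h : ℝ, 1 ≤ h ∧ Ugaheri κ h

/-- Condition (R2): `κ(x,y)` is continuous and finite off the diagonal. -/
def R2 (κ : X → X → ℝ≥0∞) : Prop :=
  ContinuousOn (fun p : X × X => κ p.1 p.2) {p : X × X | p.1 ≠ p.2} ∧
    ∀ x y : X, x ≠ y → κ x y ≠ ⊤

/-- Condition (R3): `κ(·,y) → 0` uniformly on compact sets as `y` tends to the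
Alexandroff point of `X`. -/
def R3 (κ : X → X → ℝ≥0∞) : Prop :=
  ∀ K : Set X, IsCompact K → ∀ ε : ℝ≥0∞, 0 < ε →
    ∃ K' : Set X, IsCompact K' ∧ ∀ y ∉ K', ∀ x ∈ K, κ x y < ε

/-- `μA` is the inner balayage of `ω` onto `A`: it belongs to `E'(A)` and its potential
coincides with that of `ω` nearly everywhere on `A` (up to a set of inner capacity zero). -/
def IsInnerBalayage (κ : X → X → ℝ≥0∞) (A : Set X) (ω μA : Measure X) : Prop :=
  memEClos κ A μA ∧ innerCap κ {x ∈ A | potential κ μA x ≠ potential κ ω x} = 0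

/-- `μA` is the outer balayage of `ω` onto `A`: it belongs to `E'(A)` and its potential
coincides with that of `ω` quasi-everywhere on `A` (up to a set of outer capacity zero). -/
def IsOuterBalayage (κ : X → X → ℝ≥0∞) (A : Set X) (ω μA : Measure X) : Prop :=
  memEClos κ A μA ∧ outerCap κ {x ∈ A | potential κ μA x ≠ potential κ ω x} = 0

/-- Membership in the class `Γ_{A,ω}` of positive finite-energy Radon measures whose
potential dominates that of `ω` nearly everywhere on `A`. -/
def memGamma (κ : X → X → ℝ≥0∞) (A : Set X) (ω ν : Measure X) : Prop :=
  memE κ ν ∧ innerCap κ {x ∈ A | ¬ potential κ ω x ≤ potential κ ν x} = 0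

section Helpers

variable {X : Type*} [TopologicalSpace X] [T2Space X] [LocallyCompactSpace X]
    [SecondCountableTopology X] [MeasurableSpace X] [BorelSpace X]
    {κ : X → X → ℝ≥0∞}

theorem IsRadon.locFin {μ : Measure X} (h : IsRadon μ) : IsLocallyFiniteMeasure μ := by
  have h' : μ.Regular := h
  infer_instance

theorem IsRadon.sigmaFin {μ : Measure X} (h : IsRadon μ) : SigmaFinite μ := by
  have h' : μ.Regular := h
  infer_instance

theorem IsRadon.lt_top {μ : Measure X} (h : IsRadon μ) {K : Set X} (hK : IsCompact K) :
    μ K < ⊤ := by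
  have h' : μ.Regular := h
  exact hK.measure_lt_top

theorem isRadon_of_compacts {μ : Measure X} (h : ∀ K, IsCompact K → μ K < ⊤) : IsRadon μ := by
  have : IsFiniteMeasureOnCompacts μ := ⟨fun {K} hK => h K hK⟩
  letI := TopologicalSpace.metrizableSpaceMetric X
  show μ.Regular
  infer_instance

theorem IsKernel.meas (hκ : IsKernel κ) : Measurable (Function.uncurry κ) :=
  hκ.lsc.measurable

theorem IsKernel.measPot (hκ : IsKernel κ) {μ : Measure X} (h : IsRadon μ) :
    Measurable (potential κ μ) := by
  have := h.sigmaFin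
  exact hκ.meas.lintegral_prod_right'

theorem energy_comm (hκ : IsKernel κ) {μ ν : Measure X} (hμ : IsRadon μ) (hν : IsRadon ν) :
    energy κ μ ν = energy κ ν μ := by
  have := hμ.sigmaFin
  have := hν.sigmaFin
  unfold energy potential
  rw [lintegral_lintegral_swap hκ.meas.aemeasurable]
  simp_rw [hκ.symm]

theorem energy_mono {μ ν μ' ν' : Measure X} (h : μ ≤ μ') (h' : ν ≤ ν') :
    energy κ μ ν ≤ energy κ μ' ν' :=
  lintegral_mono' h (fun _ => lintegral_mono' h' le_rfl)

theorem energy_add_left (μ ν τ : Measure X) :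
    energy κ (μ + ν) τ = energy κ μ τ + energy κ ν τ := lintegral_add_measure _ _ _

theorem energy_smul_left (c : ℝ≥0∞) (μ τ : Measure X) :
    energy κ (c • μ) τ = c * energy κ μ τ := by
  unfold energy
  rw [lintegral_smul_measure, smul_eq_mul]

theorem energy_add_right (hκ : IsKernel κ) {μ ν : Measure X} (τ : Measure X)
    (hμ : IsRadon μ) :
    energy κ τ (μ + ν) = energy κ τ μ + energy κ τ ν := by
  unfold energy
  rw [← lintegral_add_left (hκ.measPot hμ)]
  refine lintegral_congr fun x => ?_
  exact lintegral_add_measure _ _ _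

theorem energy_smul_right (hκ : IsKernel κ) {μ : Measure X} (c : ℝ≥0∞) (τ : Measure X)
    (hμ : IsRadon μ) :
    energy κ τ (c • μ) = c * energy κ τ μ := by
  unfold energy
  rw [← lintegral_const_mul _ (hκ.measPot hμ)]
  refine lintegral_congr fun x => ?_
  unfold potential
  rw [lintegral_smul_measure, smul_eq_mul]

theorem isRadon_add {μ ν : Measure X} (hμ : IsRadon μ) (hν : IsRadon ν) : IsRadon (μ + ν) :=
  isRadon_of_compacts fun K hK => by
    simpa using ⟨hμ.lt_top hK, hν.lt_top hK⟩

theorem isRadon_smul {μ : Measure X} (hμ : IsRadon μ) {c : ℝ≥0∞} (hc : c ≠ ⊤) :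
    IsRadon (c • μ) :=
  isRadon_of_compacts fun K hK => by
    simpa using ENNReal.mul_lt_top hc.lt_top (hμ.lt_top hK)

theorem isRadon_mono {μ ν : Measure X} (hμ : IsRadon μ) (h : ν ≤ μ) : IsRadon ν :=
  isRadon_of_compacts fun K hK => (h K).trans_lt (hμ.lt_top hK)

theorem memE_mono {μ ν : Measure X} (hμ : memE κ μ) (h : ν ≤ μ) : memE κ ν :=
  ⟨isRadon_mono hμ.1 h, (energy_mono h h).trans_lt hμ.2⟩

theorem energy_lt_top (hp : StrictlyPosDef κ) {μ ν : Measure X} (hμ : memE κ μ)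
    (hν : memE κ ν) : energy κ μ ν < ⊤ := by
  have h := (hp μ ν hμ.1 hν.1 hμ.2 hν.2).1
  have h2 : energy κ μ ν ≤ 2 * energy κ μ ν := by
    rw [two_mul]; exact le_self_add
  exact (h2.trans h).trans_lt (ENNReal.add_lt_top.2 ⟨hμ.2, hν.2⟩)

theorem memE_smul (hκ : IsKernel κ) {μ : Measure X} (hμ : memE κ μ) {c : ℝ≥0∞} (hc : c ≠ ⊤) :
    memE κ (c • μ) := by
  refine ⟨isRadon_smul hμ.1 hc, ?_⟩
  unfold FiniteEnergy
  rw [energy_smul_left, energy_smul_right hκ _ _ hμ.1]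
  exact ENNReal.mul_lt_top hc.lt_top (ENNReal.mul_lt_top hc.lt_top hμ.2)

theorem memE_add (hκ : IsKernel κ) (hp : StrictlyPosDef κ) {μ ν : Measure X} (hμ : memE κ μ)
    (hν : memE κ ν) : memE κ (μ + ν) := by
  refine ⟨isRadon_add hμ.1 hν.1, ?_⟩
  unfold FiniteEnergy
  rw [energy_add_left, energy_add_right hκ _ hμ.1, energy_add_right hκ _ hμ.1]
  simp only [ENNReal.add_lt_top]
  exact ⟨⟨hμ.2, energy_lt_top hp hμ hν⟩, energy_lt_top hp hν hμ, hν.2⟩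

theorem memE_zero : memE κ (0 : Measure X) :=
  ⟨isRadon_of_compacts fun K _ => by simp, by simp [FiniteEnergy, energy]⟩

/-- Real-valued mutual energy. -/
noncomputable def rE (κ : X → X → ℝ≥0∞) (μ ν : Measure X) : ℝ := (energy κ μ ν).toReal

theorem rE_comm (hκ : IsKernel κ) {μ ν : Measure X} (hμ : memE κ μ) (hν : memE κ ν) :
    rE κ μ ν = rE κ ν μ := by
  unfold rE; rw [energy_comm hκ hμ.1 hν.1]

theorem rE_nonneg (μ ν : Measure X) : 0 ≤ rE κ μ ν := ENNReal.toReal_nonneg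

/-- Energy of a positive combination. -/
theorem rE_comb (hκ : IsKernel κ) (hp : StrictlyPosDef κ) {μ ν : Measure X}
    (hμ : memE κ μ) (hν : memE κ ν) {a b : ℝ} (ha : 0 ≤ a) (hb : 0 ≤ b) :
    rE κ (ENNReal.ofReal a • μ + ENNReal.ofReal b • ν)
      (ENNReal.ofReal a • μ + ENNReal.ofReal b • ν)
      = a ^ 2 * rE κ μ μ + 2 * a * b * rE κ μ ν + b ^ 2 * rE κ ν ν := by
  have h1 := hμ.2.ne
  have h2 := hν.2.ne
  have h3 := (energy_lt_top hp hμ hν).ne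
  have ra := isRadon_smul hμ.1 (ENNReal.ofReal_ne_top (r := a))
  unfold rE
  rw [energy_add_left, energy_add_right hκ _ ra, energy_add_right hκ _ ra,
    energy_smul_left, energy_smul_left, energy_smul_left, energy_smul_left,
    energy_smul_right hκ _ _ hμ.1, energy_smul_right hκ _ _ hμ.1,
    energy_smul_right hκ _ _ hν.1, energy_smul_right hκ _ _ hν.1,
    energy_comm hκ hν.1 hμ.1]
  have f : ∀ (c d : ℝ) (e : ℝ≥0∞), e ≠ ⊤ → ENNReal.ofReal c * (ENNReal.ofReal d * e) ≠ ⊤ :=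
    fun c d e he => ENNReal.mul_ne_top ENNReal.ofReal_ne_top
      (ENNReal.mul_ne_top ENNReal.ofReal_ne_top he)
  rw [ENNReal.toReal_add, ENNReal.toReal_add, ENNReal.toReal_add]
  · simp only [ENNReal.toReal_mul, ENNReal.toReal_ofReal ha, ENNReal.toReal_ofReal hb]
    ring
  · exact f _ _ _ h3
  · exact f _ _ _ h2
  · exact f _ _ _ h1
  · exact f _ _ _ h3
  · exact ENNReal.add_ne_top.2 ⟨f _ _ _ h1, f _ _ _ h3⟩
  · exact ENNReal.add_ne_top.2 ⟨f _ _ _ h3, f _ _ _ h2⟩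

theorem memE_comb (hκ : IsKernel κ) (hp : StrictlyPosDef κ) {μ ν : Measure X}
    (hμ : memE κ μ) (hν : memE κ ν) (a b : ℝ) :
    memE κ (ENNReal.ofReal a • μ + ENNReal.ofReal b • ν) :=
  memE_add hκ hp (memE_smul hκ hμ ENNReal.ofReal_ne_top) (memE_smul hκ hν ENNReal.ofReal_ne_top)

theorem rE_comb_right (hκ : IsKernel κ) (hp : StrictlyPosDef κ) {μ ν τ : Measure X}
    (hμ : memE κ μ) (hν : memE κ ν) (hτ : memE κ τ) {a b : ℝ} (ha : 0 ≤ a) (hb : 0 ≤ b) :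
    rE κ τ (ENNReal.ofReal a • μ + ENNReal.ofReal b • ν)
      = a * rE κ τ μ + b * rE κ τ ν := by
  unfold rE
  rw [energy_add_right hκ _ (isRadon_smul hμ.1 (ENNReal.ofReal_ne_top (r := a))),
    energy_smul_right hκ _ _ hμ.1, energy_smul_right hκ _ _ hν.1, ENNReal.toReal_add]
  · simp only [ENNReal.toReal_mul, ENNReal.toReal_ofReal ha, ENNReal.toReal_ofReal hb]
  · exact ENNReal.mul_ne_top ENNReal.ofReal_ne_top (energy_lt_top hp hτ hμ).ne
  · exact ENNReal.mul_ne_top ENNReal.ofReal_ne_top (energy_lt_top hp hτ hν).ne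

theorem rE_pos (hp : StrictlyPosDef κ) {μ ν : Measure X} (hμ : memE κ μ) (hν : memE κ ν) :
    2 * rE κ μ ν ≤ rE κ μ μ + rE κ ν ν := by
  have h := (hp μ ν hμ.1 hν.1 hμ.2 hν.2).1
  have h' := ENNReal.toReal_mono (ENNReal.add_lt_top.2 ⟨hμ.2, hν.2⟩).ne h
  rw [ENNReal.toReal_add hμ.2.ne hν.2.ne, ENNReal.toReal_mul] at h'
  simpa [rE] using h'

theorem sDist_sq (hp : StrictlyPosDef κ) {μ ν : Measure X} (hμ : memE κ μ) (hν : memE κ ν) :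
    sDist κ μ ν ^ 2 = rE κ μ μ + rE κ ν ν - 2 * rE κ μ ν := by
  have h := rE_pos hp hμ hν
  unfold sDist
  rw [Real.sq_sqrt]
  · rfl
  · unfold rE at h; linarith

theorem sDist_comm (hκ : IsKernel κ) {μ ν : Measure X} (hμ : memE κ μ) (hν : memE κ ν) :
    sDist κ μ ν = sDist κ ν μ := by
  unfold sDist
  rw [energy_comm hκ hμ.1 hν.1, add_comm (energy κ μ μ).toReal]

/-- A substitute for Cauchy-Schwarz. -/
theorem rE_diff (hκ : IsKernel κ) (hp : StrictlyPosDef κ) {γ σ τ : Measure X}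
    (hγ : memE κ γ) (hσ : memE κ σ) (hτ : memE κ τ) {ε : ℝ} (hε : 0 < ε)
    (hd : sDist κ τ σ < ε) :
    rE κ γ σ ≤ rE κ γ τ + ε * (1 + rE κ γ γ) := by
  have h1 := sDist_sq hp hτ hσ
  have h0 : 0 ≤ sDist κ τ σ := Real.sqrt_nonneg _
  have h2 : sDist κ τ σ ^ 2 ≤ ε ^ 2 := by gcongr
  have h3 := rE_pos hp hσ (memE_comb hκ hp hτ hγ 1 ε)
  rw [rE_comb hκ hp hτ hγ zero_le_one hε.le, rE_comb_right hκ hp hτ hγ hσ zero_le_one hε.le,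
    rE_comm hκ hσ hτ, rE_comm hκ hσ hγ, rE_comm hκ hτ hγ] at h3
  have hg := rE_nonneg (κ := κ) γ γ
  have h4 : ε * (2 * (rE κ γ σ - rE κ γ τ)) ≤ ε * (ε * (1 + rE κ γ γ)) := by nlinarith
  have h5 := le_of_mul_le_mul_left h4 hε
  have : 0 ≤ ε * (1 + rE κ γ γ) := by positivity
  linarith

/-- Urysohn function for a compact set. -/
theorem exists_bump {L : Set X} (hL : IsCompact L) :
    ∃ f : X → ℝ, Continuous f ∧ HasCompactSupport f ∧ (∀ x ∈ L, f x = 1) ∧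
      ∀ x, 0 ≤ f x ∧ f x ≤ 1 := by
  obtain ⟨f, h1, -, h3, h4⟩ := exists_continuous_one_zero_of_isCompact hL isClosed_empty
    (disjoint_empty L)
  exact ⟨f, f.continuous, h3, fun x hx => h1 hx, fun x => ⟨(h4 x).1, (h4 x).2⟩⟩

theorem integrable_bump {μ : Measure X} (hμ : IsRadon μ) {f : X → ℝ} (hf : Continuous f)
    (hc : HasCompactSupport f) : Integrable f μ := by
  have : μ.Regular := hμ
  exact hf.integrable_of_hasCompactSupport hc

theorem measure_le_integral {μ : Measure X} (hμ : IsRadon μ) {f : X → ℝ} (hf : Continuous f)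
    (hc : HasCompactSupport f) {L : Set X} (hL : IsCompact L) (h1 : ∀ x ∈ L, f x = 1)
    (h0 : ∀ x, 0 ≤ f x) : (μ L).toReal ≤ ∫ x, f x ∂μ := by
  have hi := integrable_bump hμ hf hc
  have h := setIntegral_le_integral (s := L) hi (Eventually.of_forall h0)
  rw [setIntegral_congr_fun hL.measurableSet (g := fun _ => (1:ℝ)) h1] at h
  simpa [Measure.real] using h

theorem integral_le_measure {μ : Measure X} (hμ : IsRadon μ) {f : X → ℝ} (hf : Continuous f)
    (hc : HasCompactSupport f) 
    (h0 : ∀ x, f x ≤ 1) : ∫ x, f x ∂μ ≤ (μ (tsupport f)).toReal := by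
  have hi := integrable_bump hμ hf hc
  have hL : IsCompact (tsupport f) := hc
  rw [← setIntegral_eq_integral_of_forall_compl_eq_zero (s := tsupport f)
    (fun x hx => image_eq_zero_of_notMem_tsupport hx)]
  have h := setIntegral_mono_on (g := fun _ => (1:ℝ)) hi.integrableOn
    (integrableOn_const (hμ.lt_top hL).ne) hL.measurableSet (fun x _ => h0 x)
  simpa [Measure.real] using h

/-- Compact sets have finite capacity. -/
theorem compact_bound (hκ : IsKernel κ) (hP : Perfect κ) {L : Set X} (hL : IsCompact L) :
    ∃ C : ℝ, 0 < C ∧ ∀ μ, memE κ μ → (μ L).toReal ^ 2 ≤ C * rE κ μ μ := by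
  by_contra hcon
  push Not at hcon
  have H : ∀ n : ℕ, ∃ μ, memE κ μ ∧ (μ L).toReal = 1 ∧ sDist κ μ 0 ≤ 1 / ((n:ℝ) + 1) := by
    intro n
    obtain ⟨μ, hμ, h⟩ := hcon (((n:ℝ) + 1) ^ 2) (by positivity)
    have he := rE_nonneg (κ := κ) μ μ
    have hm : 0 < (μ L).toReal := by
      have h0 : 0 ≤ (μ L).toReal := ENNReal.toReal_nonneg
      rcases h0.lt_or_eq with h1 | h1
      · exact h1
      · rw [← h1] at h
        have : 0 ≤ ((n:ℝ) + 1) ^ 2 * rE κ μ μ := by positivity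
        norm_num at h; linarith
    set c : ℝ := ((μ L).toReal)⁻¹ with hc
    have hc0 : 0 < c := inv_pos.2 hm
    have hmem : memE κ (ENNReal.ofReal c • μ) := memE_smul hκ hμ ENNReal.ofReal_ne_top
    refine ⟨_, hmem, ?_, ?_⟩
    · simp only [Measure.smul_apply, smul_eq_mul, ENNReal.toReal_mul, ENNReal.toReal_ofReal hc0.le]
      exact inv_mul_cancel₀ hm.ne'
    · have hs := sDist_sq hP.posdef hmem memE_zero
      have hz : rE κ (0 : Measure X) 0 = 0 := by simp [rE, energy]
      have hz' : rE κ (ENNReal.ofReal c • μ) 0 = 0 := by simp [rE, energy, potential]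
      have hcc := rE_comb hκ hP.posdef hμ memE_zero hc0.le le_rfl
      simp only [ENNReal.ofReal_zero, smul_zero, add_zero] at hcc
      rw [hz, hz', hcc] at hs
      apply le_of_sq_le_sq _ (by positivity)
      rw [hs]
      have : c ^ 2 * rE κ μ μ ≤ 1 / ((n:ℝ) + 1) ^ 2 := by
        rw [le_div_iff₀ (by positivity), hc, inv_pow, mul_assoc, inv_mul_le_iff₀ (by positivity)]
        nlinarith
      rw [one_div_pow]
      linarith
  choose μ hμ h1 hd using H
  have hlim : Tendsto (fun j => sDist κ (μ j) 0) atTop (nhds 0) :=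
    squeeze_zero (fun _ => Real.sqrt_nonneg _) hd tendsto_one_div_add_atTop_nhds_zero_nat
  obtain ⟨f, hf, hc, hf1, hf0⟩ := exists_bump hL
  have hv := hP.finerThanVague μ 0 hμ memE_zero hlim f hf hc
  have : (1:ℝ) ≤ ∫ x, f x ∂(0 : Measure X) := by
    refine ge_of_tendsto' hv fun j => ?_
    rw [← h1 j]
    exact measure_le_integral (hμ j).1 hf hc hL hf1 fun x => (hf0 x).1
  norm_num at this

/-- Limits of measures on a compact set stay there. -/
theorem null_of_vague {K : Set X} (hK : IsCompact K) {μ : ℕ → Measure X} {γ : Measure X}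
    (hγ : IsRadon γ) (h : ∀ j, μ j Kᶜ = 0) (hv : VagueTendsto μ γ) : γ Kᶜ = 0 := by
  have hreg : γ.Regular := hγ
  rw [hK.isClosed.isOpen_compl.measure_eq_iSup_isCompact]
  simp only [ENNReal.iSup_eq_zero]
  intro Q hQ hQc
  obtain ⟨f, h1, h2, h3, h4⟩ := exists_continuous_one_zero_of_isCompact hQc hK.isClosed
    (Set.disjoint_left.2 fun x hx hx' => hQ hx hx')
  have hl := hv f f.continuous h3
  have hz : ∀ j, ∫ x, f x ∂(μ j) = 0 := by
    intro j
    apply integral_eq_zero_of_ae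
    have : ∀ᵐ x ∂(μ j), x ∈ K := by
      rw [ae_iff]; exact h j
    filter_upwards [this] with x hx
    exact h2 hx
  simp only [hz] at hl
  have h5 := tendsto_nhds_unique hl tendsto_const_nhds
  have h6 := measure_le_integral hγ f.continuous h3 hQc (fun x hx => h1 hx) (fun x => (h4 x).1)
  rw [h5] at h6
  have h7 : (γ Q).toReal = 0 := le_antisymm h6 ENNReal.toReal_nonneg
  exact ((ENNReal.toReal_eq_zero_iff _).1 h7).resolve_right (hγ.lt_top hQc).ne

theorem integral_eq_of_conc {μ : Measure X} {K : Set X} (hK : IsCompact K)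
    (h : μ Kᶜ = 0) {f : X → ℝ} (h1 : ∀ x ∈ K, f x = 1) : ∫ x, f x ∂μ = (μ K).toReal := by
  have hae : ∀ᵐ x ∂μ, x ∈ K := by
    rw [ae_iff]; exact h
  have h2 : μ.restrict K = μ := Measure.restrict_eq_self_of_ae_mem hae
  have h3 : ∫ x, f x ∂μ = ∫ x in K, f x ∂μ := by rw [h2]
  rw [h3, setIntegral_congr_fun hK.measurableSet (g := fun _ => (1:ℝ)) h1]
  simp [Measure.real]

/-- The Gauss functional. -/
noncomputable def gJ (κ : X → X → ℝ≥0∞) (K : Set X) (μ : Measure X) : ℝ :=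
  rE κ μ μ - 2 * (μ K).toReal

theorem memEOn_comb (hκ : IsKernel κ) (hp : StrictlyPosDef κ) {K : Set X} {μ ν : Measure X}
    (hμ : memEOn κ K μ) (hν : memEOn κ K ν) (a b : ℝ) :
    memEOn κ K (ENNReal.ofReal a • μ + ENNReal.ofReal b • ν) :=
  ⟨memE_comb hκ hp hμ.1 hν.1 a b, by simp [hμ.2, hν.2]⟩

theorem gJ_comb (hκ : IsKernel κ) (hp : StrictlyPosDef κ) {K : Set X} (hK : IsCompact K)
    {μ ν : Measure X} (hμ : memE κ μ) (hν : memE κ ν) {a b : ℝ} (ha : 0 ≤ a) (hb : 0 ≤ b) :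
    gJ κ K (ENNReal.ofReal a • μ + ENNReal.ofReal b • ν) =
      a ^ 2 * rE κ μ μ + 2 * a * b * rE κ μ ν + b ^ 2 * rE κ ν ν
        - 2 * (a * (μ K).toReal + b * (ν K).toReal) := by
  unfold gJ
  rw [rE_comb hκ hp hμ hν ha hb, Measure.add_apply, Measure.smul_apply, Measure.smul_apply,
    smul_eq_mul, smul_eq_mul, ENNReal.toReal_add, ENNReal.toReal_mul, ENNReal.toReal_mul,
    ENNReal.toReal_ofReal ha, ENNReal.toReal_ofReal hb]
  · exact ENNReal.mul_ne_top ENNReal.ofReal_ne_top (hμ.1.lt_top hK).ne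
  · exact ENNReal.mul_ne_top ENNReal.ofReal_ne_top (hν.1.lt_top hK).ne

/-- Existence of a minimizer of the Gauss functional. -/
theorem exists_min (hκ : IsKernel κ) (hP : Perfect κ) {K : Set X} (hK : IsCompact K) :
    ∃ γ, memEOn κ K γ ∧ ∀ μ, memEOn κ K μ → gJ κ K γ ≤ gJ κ K μ := by
  have hp := hP.posdef
  obtain ⟨C, hC, hCb⟩ := compact_bound hκ hP hK
  set S : Set ℝ := {r | ∃ μ, memEOn κ K μ ∧ gJ κ K μ = r} with hS
  have hbdd : BddBelow S := by
    refine ⟨-C, ?_⟩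
    rintro r ⟨μ, hμ, rfl⟩
    have h := hCb μ hμ.1
    unfold gJ
    have h2 : C * (2 * (μ K).toReal - C) ≤ C * rE κ μ μ := by
      nlinarith [sq_nonneg ((μ K).toReal - C)]
    have := le_of_mul_le_mul_left h2 hC
    linarith
  have hne : S.Nonempty := ⟨_, 0, ⟨memE_zero, by simp⟩, rfl⟩
  set m := sInf S with hm
  have hmle : ∀ μ, memEOn κ K μ → m ≤ gJ κ K μ := fun μ hμ => csInf_le hbdd ⟨μ, hμ, rfl⟩
  have hex : ∀ n : ℕ, ∃ μ, memEOn κ K μ ∧ gJ κ K μ < m + 1 / ((n:ℝ) + 1) := by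
    intro n
    obtain ⟨r, ⟨μ, hμ, rfl⟩, hr⟩ := exists_lt_of_csInf_lt hne
      (lt_add_of_pos_right m (Nat.one_div_pos_of_nat (α := ℝ) (n := n)))
    exact ⟨μ, hμ, hr⟩
  choose μ hμ hJ using hex
  have hcau : ∀ ε : ℝ, 0 < ε → ∃ N, ∀ i ≥ N, ∀ j ≥ N, sDist κ (μ i) (μ j) < ε := by
    intro ε hε
    obtain ⟨N, hN⟩ := exists_nat_one_div_lt (show 0 < ε ^ 2 / 4 by positivity)
    refine ⟨N, fun i hi j hj => ?_⟩
    have hi' : 1 / ((i:ℝ) + 1) ≤ 1 / ((N:ℝ) + 1) := Nat.one_div_le_one_div hi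
    have hj' : 1 / ((j:ℝ) + 1) ≤ 1 / ((N:ℝ) + 1) := Nat.one_div_le_one_div hj
    have h1 := hmle _ (memEOn_comb hκ hp (hμ i) (hμ j) (1/2) (1/2))
    rw [gJ_comb hκ hp hK (hμ i).1 (hμ j).1 (by norm_num) (by norm_num)] at h1
    have h2 := hJ i
    have h3 := hJ j
    unfold gJ at h2 h3
    have h4 := sDist_sq hp (hμ i).1 (hμ j).1
    apply lt_of_pow_lt_pow_left₀ 2 hε.le
    rw [h4]
    linarith
  obtain ⟨γ, hγ, hlim⟩ := hP.complete μ (fun j => (hμ j).1) hcau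
  have hv := hP.finerThanVague μ γ (fun j => (hμ j).1) hγ hlim
  have hγK := null_of_vague hK hγ.1 (fun j => (hμ j).2) hv
  refine ⟨γ, ⟨hγ, hγK⟩, fun ρ hρ => le_trans ?_ (hmle ρ hρ)⟩
  obtain ⟨f, hf, hc, hf1, hf0⟩ := exists_bump hK
  have hmass := hv f hf hc
  rw [integral_eq_of_conc hK hγK hf1] at hmass
  simp only [fun j => integral_eq_of_conc hK (hμ j).2 hf1] at hmass
  have hg := rE_nonneg (κ := κ) γ γ
  have key : ∀ ε : ℝ, 0 < ε → rE κ γ γ - 2 * (ε * (1 + rE κ γ γ)) - 2 * (γ K).toReal ≤ m := by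
    intro ε hε
    have hR : Tendsto (fun j : ℕ => m + 1 / ((j:ℝ) + 1) + 2 * (μ j K).toReal) atTop
        (nhds (m + 0 + 2 * (γ K).toReal)) :=
      (tendsto_const_nhds.add tendsto_one_div_add_atTop_nhds_zero_nat).add (hmass.const_mul 2)
    have hle : rE κ γ γ - 2 * (ε * (1 + rE κ γ γ)) ≤ m + 0 + 2 * (γ K).toReal := by
      refine ge_of_tendsto hR ?_
      filter_upwards [hlim.eventually (gt_mem_nhds hε)] with j hj
      have h1 := rE_diff hκ hp hγ hγ (hμ j).1 hε hj
      have h2 := sDist_sq hp (hμ j).1 hγ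
      rw [rE_comm hκ (hμ j).1 hγ] at h2
      have h3 := hJ j
      unfold gJ at h3
      nlinarith [sq_nonneg (sDist κ (μ j) γ)]
    linarith
  unfold gJ
  by_contra hlt
  push Not at hlt
  have hpos : 0 < (rE κ γ γ - 2 * (γ K).toReal - m) / (4 * (1 + rE κ γ γ)) := by
    apply div_pos <;> linarith
  have := key _ hpos
  have h5 : (rE κ γ γ - 2 * (γ K).toReal - m) / (4 * (1 + rE κ γ γ)) * (1 + rE κ γ γ)
      = (rE κ γ γ - 2 * (γ K).toReal - m) / 4 := by
    field_simp
  rw [h5] at this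
  linarith

/-- Existence of the equilibrium measure. -/
theorem exists_equilibrium (hκ : IsKernel κ) (hP : Perfect κ) (hfro : Ugaheri κ 1)
    {K : Set X} (hK : IsCompact K) :
    ∃ γ, memEOn κ K γ ∧ (∀ x, potential κ γ x ≤ 1) ∧ rE κ γ γ ≤ 2 * (γ K).toReal ∧
      ∀ τ, memEOn κ K τ → (τ K).toReal ≤ rE κ γ τ := by
  have hp := hP.posdef
  obtain ⟨γ, hγ, hmin⟩ := exists_min hκ hP hK
  have hJ0 : rE κ γ γ ≤ 2 * (γ K).toReal := by
    have := hmin 0 ⟨memE_zero, by simp⟩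
    simp [gJ, rE, energy] at this
    simpa [rE, energy] using this
  have hvar : ∀ τ, memEOn κ K τ → (τ K).toReal ≤ rE κ γ τ := by
    intro τ hτ
    by_contra hlt
    push Not at hlt
    have hI := rE_nonneg (κ := κ) τ τ
    set δ := (τ K).toReal - rE κ γ τ with hδ
    have hδ0 : 0 < δ := by linarith
    set t := δ / (1 + rE κ τ τ) with ht
    have ht0 : 0 < t := by positivity
    have htt : t * (1 + rE κ τ τ) = δ := by rw [ht]; field_simp
    have h1 := hmin _ (memEOn_comb hκ hp hγ hτ 1 t)
    rw [gJ_comb hκ hp hK hγ.1 hτ.1 zero_le_one ht0.le] at h1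
    unfold gJ at h1
    nlinarith [mul_pos ht0 ht0, mul_pos ht0 hδ0]
  have hle : rE κ γ γ ≤ (γ K).toReal := by
    by_contra hlt
    push Not at hlt
    have hI := rE_nonneg (κ := κ) γ γ
    set δ := rE κ γ γ - (γ K).toReal with hδ
    have hδ0 : 0 < δ := by linarith
    have hm0 : 0 ≤ (γ K).toReal := ENNReal.toReal_nonneg
    set t := δ / (1 + rE κ γ γ) with ht
    have ht0 : 0 < t := by positivity
    have htt : t * (1 + rE κ γ γ) = δ := by rw [ht]; field_simp
    have ht1 : t ≤ 1 := by
      rw [ht, div_le_one (by positivity)]; linarith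
    have h1 := hmin _ (memEOn_comb hκ hp hγ hγ (1 - t) 0)
    rw [gJ_comb hκ hp hK hγ.1 hγ.1 (by linarith) le_rfl] at h1
    unfold gJ at h1
    nlinarith [mul_pos ht0 ht0, mul_pos ht0 hδ0]
  have hpm := hκ.measPot hγ.1.1
  have haeK : ∀ᵐ x ∂γ, x ∈ K := by
    rw [ae_iff]; exact hγ.2
  have huniv : γ univ = γ K := by
    rw [← measure_add_measure_compl hK.measurableSet, hγ.2, add_zero]
  have hfinu : γ univ ≠ ⊤ := by rw [huniv]; exact (hγ.1.1.lt_top hK).ne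
  have hfm : IsFiniteMeasure γ := ⟨hfinu.lt_top⟩
  -- the potential is at least one almost everywhere
  have hge : ∀ᵐ x ∂γ, 1 ≤ potential κ γ x := by
    refine ae_le_of_forall_setLIntegral_le_of_sigmaFinite measurable_const fun s hs _ => ?_
    have hτ : memEOn κ K (γ.restrict s) :=
      ⟨memE_mono hγ.1 Measure.restrict_le_self,
        le_antisymm ((Measure.restrict_le_self (μ := γ) (s := s) Kᶜ).trans hγ.2.le) zero_le⟩
    have h1 := hvar _ hτ
    rw [rE_comm hκ hγ.1 hτ.1] at h1
    have h2 : (γ.restrict s) K = γ s := by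
      rw [Measure.restrict_apply hK.measurableSet]
      apply measure_congr
      filter_upwards [haeK] with x hx
      apply propext
      exact ⟨fun h => h.2, fun h => ⟨hx, h⟩⟩
    rw [h2] at h1
    have h3 : energy κ (γ.restrict s) γ = ∫⁻ x in s, potential κ γ x ∂γ := rfl
    simp only [lintegral_const, one_mul, Measure.restrict_apply_univ]
    rw [← h3]
    exact (ENNReal.toReal_le_toReal (measure_ne_top _ _) (energy_lt_top hp hτ.1 hγ.1).ne).1 h1
  have heq : ∀ᵐ x ∂γ, (1 : ℝ≥0∞) = potential κ γ x := by
    have hle' : ∫⁻ x, potential κ γ x ∂γ ≤ ∫⁻ _, 1 ∂γ := by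
      rw [lintegral_one, huniv]
      exact (ENNReal.toReal_le_toReal hγ.1.2.ne (measure_ne_top _ _)).1 hle
    exact ae_eq_of_ae_le_of_lintegral_le hge (by rw [lintegral_one]; exact hfinu)
      hpm.aemeasurable hle'
  refine ⟨γ, hγ, ?_, hJ0, hvar⟩
  have := hfro γ hγ.1 1 one_pos (by
    filter_upwards [heq] with x hx
    rw [← hx]; simp)
  simpa using this

theorem innerCap_mono {S T : Set X} (h : S ⊆ T) : innerCap κ S ≤ innerCap κ T := by
  unfold innerCap
  refine iSup_mono fun K => iSup_mono fun _ => ?_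
  exact iSup_le fun hK => le_iSup_of_le (hK.trans h) le_rfl

/-- Measures of finite energy do not charge measurable sets of zero inner capacity. -/
theorem null_of_innerCap (hκ : IsKernel κ) {γ : Measure X} (hγ : memE κ γ) {S : Set X}
    (hS : MeasurableSet S) (hfin : γ S ≠ ⊤) (h : innerCap κ S = 0) : γ S = 0 := by
  by_contra hne
  have hreg : γ.Regular := hγ.1
  obtain ⟨Q, hQS, hQ, hpos⟩ := hS.exists_lt_isCompact_of_ne_top hfin (pos_iff_ne_zero.2 hne)
  have hc : capC κ Q = 0 := by
    refine le_antisymm ?_ zero_le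
    rw [← h]
    exact le_iSup_of_le Q (le_iSup_of_le hQ (le_iSup_of_le hQS le_rfl))
  have hQt := (hγ.1.lt_top hQ).ne
  unfold capC at hc
  rw [ENNReal.inv_eq_zero] at hc
  simp only [iInf_eq_top] at hc
  have hm : memE κ (γ.restrict Q) := memE_mono hγ Measure.restrict_le_self
  have hci : (γ Q)⁻¹ ≠ ⊤ := ENNReal.inv_ne_top.2 hpos.ne'
  have hr := hc ((γ Q)⁻¹ • γ.restrict Q) ⟨by
    simp [ENNReal.inv_mul_cancel hpos.ne' hQt]⟩ (by
    simp [Measure.restrict_apply hQ.measurableSet.compl])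
  exact (memE_smul hκ hm hci).2.ne hr

end Helpers

/-- Under Frostman's maximum principle (`h = 1`), the inner balayage
`ω^A` has minimum total mass in the class `Γ_{A,ω}`. -/
theorem inner_balayage_min_total_mass
    {X : Type*} [TopologicalSpace X] [T2Space X] [LocallyCompactSpace X]
    [SecondCountableTopology X] [MeasurableSpace X] [BorelSpace X]
    (κ : X → X → ℝ≥0∞) (hκ : IsKernel κ)
    (hperf : Perfect κ) (hdom : Domination κ) (hfro : Ugaheri κ 1)
    (hR2 : R2 κ) (hR3 : R3 κ)
    (A : Set X) (hA : A ≠ Set.univ) (hcap : 0 < innerCap κ A)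
    (ω : Measure X) (hωR : IsRadon ω) (hω0 : ω ≠ 0)
    (hfin : FiniteEnergy κ ω ∨ (ω A = 0 ∧ ω Set.univ < ⊤))
    (ωA : Measure X) (hωA : IsInnerBalayage κ A ω ωA) :
    memGamma κ A ω ωA ∧
    ∀ ν : Measure X, memGamma κ A ω ν → ωA Set.univ ≤ ν Set.univ := by
  have hp := hperf.posdef
  obtain ⟨⟨hE, hclos⟩, hcap0⟩ := hωA
  refine ⟨⟨hE, ?_⟩, ?_⟩
  · refine le_antisymm ?_ zero_le
    rw [← hcap0]
    refine innerCap_mono ?_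
    rintro x ⟨hx, hne⟩
    exact ⟨hx, fun h => hne h.ge⟩
  rintro ν ⟨hν, hνcap⟩
  by_cases hνt : ν univ = ⊤
  · rw [hνt]; exact le_top
  -- comparison of energies against measures on compact subsets of `A`
  have hcomp : ∀ K : Set X, IsCompact K → K ⊆ A → ∀ γ, memEOn κ K γ →
      (∀ x, potential κ γ x ≤ 1) → rE κ γ ωA ≤ (ν univ).toReal := by
    intro K hK hKA γ hγ hU
    have haeK : ∀ᵐ x ∂γ, x ∈ K := by
      rw [ae_iff]; exact hγ.2
    have m1 := hκ.measPot hE.1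
    have m2 := hκ.measPot hωR
    have m3 := hκ.measPot hν.1
    have n1 : γ (K ∩ {x | potential κ ωA x ≠ potential κ ω x}) = 0 := by
      refine null_of_innerCap hκ hγ.1
        (hK.measurableSet.inter (measurableSet_eq_fun m1 m2).compl)
        ((measure_mono inter_subset_left).trans_lt (hγ.1.1.lt_top hK)).ne ?_
      refine le_antisymm ?_ zero_le
      rw [← hcap0]
      exact innerCap_mono fun x hx => ⟨hKA hx.1, hx.2⟩
    have n2 : γ (K ∩ {x | ¬ potential κ ω x ≤ potential κ ν x}) = 0 := by
      refine null_of_innerCap hκ hγ.1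
        (hK.measurableSet.inter (measurableSet_le m2 m3).compl)
        ((measure_mono inter_subset_left).trans_lt (hγ.1.1.lt_top hK)).ne ?_
      refine le_antisymm ?_ zero_le
      rw [← hνcap]
      exact innerCap_mono fun x hx => ⟨hKA hx.1, hx.2⟩
    have hle : energy κ γ ωA ≤ ν univ := by
      calc energy κ γ ωA ≤ energy κ γ ν := by
            refine lintegral_mono_ae ?_
            filter_upwards [haeK, measure_eq_zero_iff_ae_notMem.1 n1,
              measure_eq_zero_iff_ae_notMem.1 n2] with x hx h1 h2
            have e1 : potential κ ωA x = potential κ ω x := by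
              by_contra hh; exact h1 ⟨hx, hh⟩
            have e2 : potential κ ω x ≤ potential κ ν x := by
              by_contra hh; exact h2 ⟨hx, hh⟩
            exact e1.le.trans e2
        _ = energy κ ν γ := energy_comm hκ hγ.1.1 hν.1
        _ ≤ ∫⁻ _, 1 ∂ν := lintegral_mono hU
        _ = ν univ := lintegral_one
    exact ENNReal.toReal_mono hνt hle
  -- uniform estimate
  have hest : ∀ L : Set X, IsCompact L → ∃ G : ℝ, 0 ≤ G ∧ ∀ σ, memEOn κ A σ → ∀ ε : ℝ, 0 < ε →
      sDist κ ωA σ < ε → (σ L).toReal ≤ (ν univ).toReal + ε * G := by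
    intro L hL
    obtain ⟨C, hC, hCb⟩ := compact_bound hκ hperf hL
    refine ⟨1 + 4 * C + 1, by positivity, fun σ hσ ε hε hd => ?_⟩
    have hreg : σ.Regular := hσ.1.1
    have hLt := (hσ.1.1.lt_top hL).ne
    set N := toMeasurable σ Aᶜ with hN
    have hN0 : σ N = 0 := by rw [hN, measure_toMeasurable]; exact hσ.2
    have hLN : σ (L \ N) = σ L := measure_sdiff_null hN0
    have hmeas : MeasurableSet (L \ N) := hL.measurableSet.diff (measurableSet_toMeasurable _ _)
    obtain ⟨K, hKs, hK, hKlt⟩ := hmeas.exists_isCompact_lt_add (μ := σ)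
      (by rw [hLN]; exact hLt) (ε := ENNReal.ofReal ε) (by simpa using hε)
    rw [hLN] at hKlt
    have hKA : K ⊆ A := by
      intro x hx
      by_contra hxA
      exact (hKs hx).2 (subset_toMeasurable σ Aᶜ hxA)
    have hKL : K ⊆ L := fun x hx => (hKs hx).1
    have hKt := (hσ.1.1.lt_top hK).ne
    have hr : (σ L).toReal ≤ (σ K).toReal + ε := by
      have := ENNReal.toReal_mono (ENNReal.add_ne_top.2 ⟨hKt, ENNReal.ofReal_ne_top⟩) hKlt.le
      rwa [ENNReal.toReal_add hKt ENNReal.ofReal_ne_top, ENNReal.toReal_ofReal hε.le] at this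
    obtain ⟨γ, hγ, hU, hJ, hvar⟩ := exists_equilibrium hκ hperf hfro hK
    have h1 := hvar (σ.restrict K) ⟨memE_mono hσ.1 Measure.restrict_le_self, by
      simp [Measure.restrict_apply hK.measurableSet.compl]⟩
    rw [Measure.restrict_apply hK.measurableSet, inter_self] at h1
    have h2 : rE κ γ (σ.restrict K) ≤ rE κ γ σ :=
      ENNReal.toReal_mono (energy_lt_top hp hγ.1 hσ.1).ne
        (energy_mono le_rfl Measure.restrict_le_self)
    have h3 := rE_diff hκ hp hγ.1 hσ.1 hE hε hd
    have h4 := hcomp K hK hKA γ hγ hU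
    have hGb : rE κ γ γ ≤ 4 * C := by
      have h5 := hCb γ hγ.1
      have h6 : (γ K).toReal ≤ (γ L).toReal :=
        ENNReal.toReal_mono (hγ.1.1.lt_top hL).ne (measure_mono hKL)
      have h0 := rE_nonneg (κ := κ) γ γ
      by_contra hlt
      push Not at hlt
      have h7 : rE κ γ γ ^ 2 ≤ 4 * C * rE κ γ γ := by nlinarith
      nlinarith
    have h8 : ε * (1 + rE κ γ γ) ≤ ε * (1 + 4 * C) := by gcongr
    nlinarith
  -- vague limit
  have hseq : ∀ n : ℕ, ∃ σ, memEOn κ A σ ∧ sDist κ ωA σ < 1 / ((n:ℝ) + 1) :=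
    fun n => hclos _ Nat.one_div_pos_of_nat
  choose σ hσ hσd using hseq
  have hlim : Tendsto (fun j => sDist κ (σ j) ωA) atTop (nhds 0) := by
    refine squeeze_zero (fun _ => Real.sqrt_nonneg _) (fun j => ?_)
      tendsto_one_div_add_atTop_nhds_zero_nat
    rw [sDist_comm hκ (hσ j).1 hE]
    exact (hσd j).le
  have hv := hperf.finerThanVague σ ωA (fun j => (hσ j).1) hE hlim
  have hreg : ωA.Regular := hE.1
  rw [isOpen_univ.measure_eq_iSup_isCompact]
  refine iSup_le fun Q => iSup_le fun _ => iSup_le fun hQ => ?_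
  obtain ⟨f, hf, hc, hf1, hf0⟩ := exists_bump hQ
  obtain ⟨G, hG, hGe⟩ := hest (tsupport f) hc
  have hlimf : ∫ x, f x ∂ωA ≤ (ν univ).toReal + 0 * G := by
    refine le_of_tendsto_of_tendsto' (hv f hf hc)
      (tendsto_const_nhds.add
        ((tendsto_one_div_add_atTop_nhds_zero_nat (𝕜 := ℝ)).mul_const G)) fun j => ?_
    exact (integral_le_measure (hσ j).1.1 hf hc fun x => (hf0 x).2).trans
      (hGe (σ j) (hσ j) _ Nat.one_div_pos_of_nat (hσd j))
  have hQle := measure_le_integral hE.1 hf hc hQ hf1 fun x => (hf0 x).1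
  refine (ENNReal.toReal_le_toReal (hE.1.lt_top hQ).ne hνt).1 ?_
  linarith

end Balayage
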